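/- Let q = e^{2πi/r} with r' = r/gcd(2,r) odd. In the ribbon Hopf (ℂ/2ℤ)-bialgebra u built from quantum sl₂, the Drinfeld map applied to the antipode-twisted integral recovers the cointegral: D_{ᾱ,0}(λ_{-α} ∘ S_ᾱ^0) = Λ^α = √(r') E^{r'−1} F^{(r'−1)} T_0^α, where D_{α,β}(f) = f((R''_i)(R'_j)) (R'_i)(R''_j) is the Drinfeld map built from the R-matrix R_{ᾱ,0} and R_{0,ᾱ}. In particular u is factorizable. -/

import Mathlib

noncomputable section

/-- `q^z = e^{2πiz/r}` for `q = e^{2πi/r}`. -/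
def qp (r : ℕ) (z : ℂ) : ℂ := Complex.exp (2 * Real.pi * Complex.I * z / r)

/-- `{z} = q^z - q^{-z}`. -/
def qbr (r : ℕ) (z : ℂ) : ℂ := qp r z - qp r (-z)

/-- the quantum integer `[k] = {k}/{1}`. -/
def qint (r k : ℕ) : ℂ := qbr r k / qbr r 1

/-- the quantum factorial `[k]!`. -/
def qfact (r k : ℕ) : ℂ := ∏ j ∈ Finset.range k, qint r (j + 1)

/-- the Gaussian binomial `[n choose k]`. -/
def qbinom (r n k : ℕ) : ℂ := qfact r n / (qfact r k * qfact r (n - k))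

/-- the falling product `{z;k} = Π_{j=0}^{k-1} {z-j}`. -/
def qbrfall (r : ℕ) (z : ℂ) (k : ℕ) : ℂ := ∏ j ∈ Finset.range k, qbr r (z - j)

/-- the element `T_γ^β = (1/r') Σ_{b=0}^{r'-1} q^{-γb} K^{b+β}`. -/
def Tel {A : Type*} [Ring A] [Algebra ℂ A] (r r' : ℕ) (K : ℂ → A) (γ β : ℂ) : A :=
  (r' : ℂ)⁻¹ • ∑ b ∈ Finset.range r', qp r (-(γ * b)) • K (b + β)

/-- the divided power `F^{(a)} = ({1}^a/[a]!) F^a`. -/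
def Fdiv {A : Type*} [Ring A] [Algebra ℂ A] (r : ℕ) (F : A) (a : ℕ) : A :=
  ((qbr r 1) ^ a / qfact r a) • F ^ a

/-- The defining relations of `u_ᾱ` (quantum `sl₂` at `q = e^{2πi/r}` modulo
`K^{r/2} = q^{αr/2}`), with `r' = r / gcd(2,r)`. -/
def SL2Rel {A : Type*} [Ring A] [Algebra ℂ A] (r r' : ℕ) (α : ℂ)
    (E F : A) (K : ℂ → A) : Prop :=
  (∀ a b : ℂ, K a * K b = K (a + b)) ∧ K 0 = 1 ∧
  (∀ a : ℂ, K a * E = qp r (2 * a) • (E * K a)) ∧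
  (∀ a : ℂ, K a * F = qp r (-(2 * a)) • (F * K a)) ∧
  (E * F - F * E = (qbr r 1)⁻¹ • (K 1 - K (-1))) ∧
  E ^ r' = 0 ∧ F ^ r' = 0 ∧
  K ((r : ℂ) / 2) = qp r (α * r / 2) • (1 : A)

theorem qp_add (r : ℕ) (x y : ℂ) : qp r (x + y) = qp r x * qp r y := by
  unfold qp
  rw [← Complex.exp_add]
  congr 1
  ring

theorem qp_zero (r : ℕ) : qp r 0 = 1 := by simp [qp]

theorem r_cases (r r' : ℕ) (hr' : r' = r / Nat.gcd 2 r) :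
    r = r' ∨ r = 2 * r' := by
  rcases Nat.even_or_odd r with h | h
  · right
    have h2 : Nat.gcd 2 r = 2 := Nat.gcd_eq_left h.two_dvd
    rw [h2] at hr'
    obtain ⟨k, hk⟩ := h
    omega
  · left
    have h2 : Nat.gcd 2 r = 1 := by
      rw [← Nat.coprime_iff_gcd_eq_one]
      exact Nat.coprime_two_left.mpr h
    rw [h2] at hr'
    simpa using hr'.symm

theorem qp_period (r r' : ℕ) (hr : 0 < r) (h : r = r' ∨ r = 2 * r') (k : ℤ) :
    qp r (2 * r' * k) = 1 := by
  unfold qp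
  have hr0 : (r : ℂ) ≠ 0 := by exact_mod_cast hr.ne'
  rw [Complex.exp_eq_one_iff]
  rcases h with h | h
  · refine ⟨2 * k, ?_⟩
    rw [← h]
    push_cast
    field_simp
  · refine ⟨k, ?_⟩
    have : (r : ℂ) = 2 * r' := by exact_mod_cast h
    rw [← this]
    field_simp

theorem qp_congr (r r' : ℕ) (hr : 0 < r) (h : r = r' ∨ r = 2 * r') (x y : ℂ) (k : ℤ)
    (hxy : x = y + 2 * r' * k) : qp r x = qp r y := by
  rw [hxy, qp_add, qp_period r r' hr h, mul_one]

/-- geometric sum -/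
theorem qp_geom (r r' : ℕ) (hr : 0 < r) (h : r = r' ∨ r = 2 * r') (hodd : Odd r') (k : ℤ) :
    ∑ b ∈ Finset.range r', qp r (2 * k * b) = if (r' : ℤ) ∣ k then (r' : ℂ) else 0 := by
  split_ifs with hk
  · obtain ⟨m, rfl⟩ := hk
    rw [Finset.sum_congr rfl (g := fun _ => (1 : ℂ))]
    · simp
    · intro b _
      rw [← qp_period r r' hr h (m * b)]
      congr 1
      push_cast
      ring
  · have h1 : ∀ b : ℕ, qp r (2 * k * b) = (qp r (2 * k)) ^ b := by
      intro b
      unfold qp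
      rw [← Complex.exp_nat_mul]
      congr 1
      ring
    simp_rw [h1]
    have hne : qp r (2 * k) ≠ 1 := by
      intro hq
      apply hk
      unfold qp at hq
      rw [Complex.exp_eq_one_iff] at hq
      obtain ⟨n, hn⟩ := hq
      have hr0 : (r : ℂ) ≠ 0 := by exact_mod_cast hr.ne'
      have hpi := Complex.two_pi_I_ne_zero
      have h2 : (2 * k : ℂ) = n * r := by
        have : (2 * Real.pi * Complex.I : ℂ) * (2 * k) = (2 * Real.pi * Complex.I) * (n * r) := by
          field_simp at hn
          linear_combination (2 * Real.pi * Complex.I : ℂ) * hn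
        exact mul_left_cancel₀ hpi this
      have h3 : 2 * k = n * r := by exact_mod_cast h2
      have h4 : (r' : ℤ) ∣ 2 * k := by
        rw [h3]
        rcases h with h | h
        · rw [h]; exact dvd_mul_left _ _
        · rw [h]; push_cast; exact ⟨n * 2, by ring⟩
      have hc : IsCoprime (r' : ℤ) 2 := by
        rw [Int.isCoprime_iff_gcd_eq_one]
        exact_mod_cast (Nat.coprime_two_right.mpr hodd)
      exact hc.dvd_of_dvd_mul_left h4
    rw [geom_sum_eq hne, ← h1]
    have := qp_period r r' hr h k
    rw [show (2 * k * r' : ℂ) = 2 * r' * k by ring, this]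
    simp

theorem sum_reindex {M : Type*} [AddCommMonoid M] (p : ℕ) (hp : 0 < p) (f : ℤ → M)
    (hf : ∀ a k : ℤ, f (a + p * k) = f a) (g : ℕ → ℤ)
    (hg : ∀ a b : ℕ, a < p → b < p → (p : ℤ) ∣ g a - g b → a = b) :
    ∑ b ∈ Finset.range p, f (g b) = ∑ b ∈ Finset.range p, f b := by
  have hp' : (p : ℤ) ≠ 0 := by exact_mod_cast hp.ne'
  have hpos : (0 : ℤ) < p := by exact_mod_cast hp
  have hcast : ∀ a : ℕ, (((g a % p).toNat : ℕ) : ℤ) = g a % p := fun a =>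
    Int.toNat_of_nonneg (Int.emod_nonneg _ hp')
  have hmaps : ∀ a ∈ Finset.range p, (g a % p).toNat ∈ Finset.range p := by
    intro a _
    rw [Finset.mem_range]
    have := Int.emod_lt_of_pos (g a) hpos
    have := hcast a
    omega
  have hinj : Set.InjOn (fun a : ℕ => (g a % p).toNat) (Finset.range p : Set ℕ) := by
    intro a ha b hb hab
    apply hg a b (by simpa using ha) (by simpa using hb)
    have h1 : g a % p = g b % p := by
      rw [← hcast a, ← hcast b]
      exact_mod_cast hab
    exact Int.ModEq.dvd (Int.ModEq.symm h1)
  refine Finset.sum_nbij (fun a : ℕ => (g a % p).toNat) hmaps hinj ?_ ?_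
  · exact Finset.surjOn_of_injOn_of_card_le _ hmaps hinj le_rfl
  · intro a _
    rw [hcast a]
    conv_lhs => rw [← Int.emod_add_mul_ediv (g a) p]
    exact hf _ _

section rel
variable {A : Type*} [Ring A] [Algebra ℂ A] {r r' : ℕ} {α : ℂ} {E F : A} {K : ℂ → A}

theorem K_period (h : r = r' ∨ r = 2 * r') (H : SL2Rel r r' α E F K) (k : ℤ) :
    K ((r' : ℂ) * k) = qp r (α * r' * k) • (1 : A) := by
  obtain ⟨hK, hK0, -, -, -, -, -, hKr⟩ := H
  have h1 : K (r' : ℂ) = qp r (α * r') • (1 : A) := by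
    rcases h with h | h
    · rw [← h]
      have : (r : ℂ) = r / 2 + r / 2 := by ring
      rw [this, ← hK, hKr, smul_mul_smul_comm, ← qp_add, mul_one]
      congr 2
      ring
    · have h2 : (r : ℂ) = 2 * r' := by exact_mod_cast h
      rw [h2] at hKr
      rw [show (2 * r' / 2 : ℂ) = r' by ring, show (α * (2 * r') / 2 : ℂ) = α * r' by ring] at hKr
      exact hKr
  have hm1 : K (-(r' : ℂ)) = qp r (-(α * r')) • (1 : A) := by
    have e1 : K (-(r' : ℂ)) * K (r' : ℂ) = 1 := by rw [hK]; simp [hK0]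
    rw [h1, mul_smul_comm, mul_one] at e1
    have e2 := congrArg (fun x => qp r (-(α * r')) • x) e1
    simp only [smul_smul, ← qp_add] at e2
    simpa [qp_zero] using e2
  induction k using Int.induction_on with
  | zero => simp [hK0, qp_zero]
  | succ i ih =>
    push_cast at ih ⊢
    rw [mul_add, mul_one, ← hK, ih, h1, smul_mul_smul_comm, ← qp_add, mul_one]
    congr 2
    ring
  | pred i ih =>
    push_cast at ih ⊢
    rw [mul_sub, mul_one, sub_eq_add_neg, ← hK, ih, hm1, smul_mul_smul_comm, ← qp_add, mul_one]
    congr 2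
    ring

theorem K_E_pow (H : SL2Rel r r' α E F K) (a : ℂ) (n : ℕ) :
    K a * E ^ n = qp r (2 * a * n) • (E ^ n * K a) := by
  obtain ⟨-, -, hE, -⟩ := H
  induction n with
  | zero => simp [qp_zero]
  | succ n ih =>
    rw [pow_succ, ← mul_assoc, ih, smul_mul_assoc, mul_assoc (E ^ n), hE, mul_smul_comm, smul_smul,
      ← qp_add, ← mul_assoc]
    congr 2
    push_cast
    ring

theorem K_F_pow (H : SL2Rel r r' α E F K) (a : ℂ) (n : ℕ) :
    K a * F ^ n = qp r (-(2 * a * n)) • (F ^ n * K a) := by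
  obtain ⟨-, -, -, hF, -⟩ := H
  induction n with
  | zero => simp [qp_zero]
  | succ n ih =>
    rw [pow_succ, ← mul_assoc, ih, smul_mul_assoc, mul_assoc (F ^ n), hF, mul_smul_comm, smul_smul,
      ← qp_add, ← mul_assoc]
    congr 2
    push_cast
    ring

theorem K_Fdiv (H : SL2Rel r r' α E F K) (a : ℂ) (n : ℕ) :
    K a * Fdiv r F n = qp r (-(2 * a * n)) • (Fdiv r F n * K a) := by
  unfold Fdiv
  rw [mul_smul_comm, K_F_pow H, smul_mul_assoc, smul_comm]

theorem EK_pow (H : SL2Rel r r' α E F K) (n : ℕ) :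
    (E * K (-1)) ^ n = qp r (-(n * (n - 1))) • (E ^ n * K (-n)) := by
  have hK := H.1
  induction n with
  | zero => simp [qp_zero, H.2.1]
  | succ n ih =>
    have h1 := K_E_pow H (-n) 1
    rw [pow_one] at h1
    rw [pow_succ, ih, smul_mul_assoc, mul_assoc, ← mul_assoc (K _), h1, smul_mul_assoc,
      mul_smul_comm, smul_smul, ← qp_add, mul_assoc E, hK, ← mul_assoc (E ^ n), ← pow_succ]
    congr 2
    · congr 1
      push_cast
      ring
    · congr 1
      push_cast
      ring

theorem KF_pow (H : SL2Rel r r' α E F K) (n : ℕ) :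
    (K 1 * F) ^ n = qp r (-(n * (n + 1))) • (F ^ n * K n) := by
  have hK := H.1
  induction n with
  | zero => simp [qp_zero, H.2.1]
  | succ n ih =>
    have h1 := K_F_pow H (n + 1) 1
    rw [pow_one] at h1
    rw [pow_succ, ih, smul_mul_assoc, mul_assoc, ← mul_assoc (K _), hK, h1,
      mul_smul_comm, smul_smul, ← qp_add, ← mul_assoc, ← pow_succ]
    congr 2
    · congr 1
      push_cast
      ring
    · congr 1
      push_cast
      ring

theorem K_Tel (hr : 0 < r) (hp : 0 < r') (h : r = r' ∨ r = 2 * r') (H : SL2Rel r r' α E F K)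
    (a n : ℤ) (γ : ℂ) (hγ : γ = 2 * n + α) :
    K a * Tel r r' K γ 0 = qp r (γ * a) • Tel r r' K γ 0 := by
  unfold Tel
  rw [mul_smul_comm, smul_comm (qp r _)]
  congr 1
  rw [Finset.mul_sum, Finset.smul_sum]
  have key := sum_reindex r' hp (fun k : ℤ => qp r (-(γ * k)) • K k) ?_ (fun b => b + a) ?_
  · simp only [Int.cast_natCast] at key
    simp only [add_zero]
    rw [← Finset.smul_sum, ← key, Finset.smul_sum]
    refine Finset.sum_congr rfl fun b _ => ?_
    rw [mul_smul_comm, H.1, smul_smul, ← qp_add]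
    push_cast
    congr 2
    · ring
    · ring
  · intro b k
    have := K_period h H k
    push_cast
    rw [← H.1, this, mul_smul_comm, mul_one, smul_smul, ← qp_add]
    congr 1
    apply qp_congr r r' hr h _ _ (-(n * k))
    rw [hγ]; push_cast; ring
  · intro b c hb hc hd
    have hd' : (r' : ℤ) ∣ (b : ℤ) - c := by simpa using hd
    have := Int.eq_zero_of_abs_lt_dvd hd' (by rw [abs_lt]; constructor <;> omega)
    omega

end rel

section anti
variable {Ap An : Type*} [Ring Ap] [Algebra ℂ Ap] [Ring An] [Algebra ℂ An]

theorem S_Tel (r r' : ℕ) (hr : 0 < r) (hp : 0 < r') (h : r = r' ∨ r = 2 * r') (α : ℂ)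
    (Kp : ℂ → Ap) (En Fn : An) (Kn : ℂ → An) (hn : SL2Rel r r' (-α) En Fn Kn)
    (S : Ap →ₗ[ℂ] An) (hSK : ∀ γ : ℂ, S (Kp γ) = Kn (-γ)) (b n : ℕ) (k : ℤ)
    (hnb : (n : ℤ) + b = r' * k) :
    S (Tel r r' Kp (2 * (b : ℂ) + α) 0) = Tel r r' Kn (2 * n + (-α)) 0 := by
  have hnb' : (n : ℂ) + b = r' * k := by exact_mod_cast hnb
  unfold Tel
  rw [map_smul, map_sum]
  congr 1
  have key := sum_reindex r' hp (fun a : ℤ => qp r ((2 * b + α) * a) • Kn a) ?_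
    (fun a => -(a : ℤ)) ?_
  · simp only [Int.cast_natCast, Int.cast_neg] at key
    simp only [add_zero, map_smul, hSK]
    rw [Finset.sum_congr rfl, key]
    · refine Finset.sum_congr rfl fun a _ => ?_
      congr 1
      apply qp_congr r r' hr h _ _ (k * a)
      push_cast
      linear_combination (2 * a : ℂ) * hnb'
    · intro a _
      congr 2
      ring
  · intro a k
    have := K_period h hn k
    push_cast
    rw [← hn.1, this, mul_smul_comm, mul_one, smul_smul, ← qp_add]
    congr 1
    apply qp_congr r r' hr h _ _ (b * k)
    push_cast; ring
  · intro b c hb hc hd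
    have hd' : (r' : ℤ) ∣ (c : ℤ) - b := by
      convert hd using 1
      ring
    have := Int.eq_zero_of_abs_lt_dvd hd' (by rw [abs_lt]; constructor <;> omega)
    omega

theorem S_pow (S : Ap →ₗ[ℂ] An) (hSmul : ∀ x y : Ap, S (x * y) = S y * S x) (h1 : S 1 = 1)
    (x : Ap) (n : ℕ) : S (x ^ n) = S x ^ n := by
  induction n with
  | zero => simp [h1]
  | succ n ih => rw [pow_succ, hSmul, ih, ← pow_succ']

theorem lam_S (r r' : ℕ) (hr : 0 < r) (hp0 : 0 < r') (h : r = r' ∨ r = 2 * r')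
    (hodd : Odd r') (α : ℂ)
    (Ep Fp : Ap) (Kp : ℂ → Ap) (En Fn : An) (Kn : ℂ → An)
    (hp : SL2Rel r r' α Ep Fp Kp) (hn : SL2Rel r r' (-α) En Fn Kn)
    (S : Ap →ₗ[ℂ] An)
    (hSmul : ∀ x y : Ap, S (x * y) = S y * S x)
    (hSE : S Ep = -(En * Kn (-1))) (hSF : S Fp = -(Kn 1 * Fn))
    (hSK : ∀ γ : ℂ, S (Kp γ) = Kn (-γ))
    (lam : An →ₗ[ℂ] ℂ)
    (hlam : ∀ ℓ m n : ℕ, ℓ < r' → m < r' → n < r' →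
      lam (En ^ ℓ * Fdiv r Fn m * Tel r r' Kn (2 * n + (-α)) 0) =
        if ℓ = r' - 1 ∧ m = r' - 1 then
          qp r ((2 * (n : ℂ) + (-α)) * (1 - r')) / ((Real.sqrt r' : ℝ) : ℂ) else 0)
    (b c b' c' : ℕ) (hc : c < r') (hc' : c' < r') :
    lam (S (Tel r r' Kp (2 * (b : ℂ) + α) 0 * Fdiv r Fp c * Kp (b' : ℂ) * Ep ^ c')) =
      if c' = r' - 1 ∧ c = r' - 1 then
        qp r (-2 * b' + (2 * b + α) * b' - 2 * b + α * (r' - 1)) / ((Real.sqrt r' : ℝ) : ℂ)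
      else 0 := by
  have hS1 : S 1 = 1 := by
    rw [← hp.2.1, hSK, neg_zero, hn.2.1]
  have hp1 : (r' : ℤ) ≠ 0 := by exact_mod_cast hp0.ne'
  obtain ⟨n, k, hnlt, hnb⟩ : ∃ (n : ℕ) (k : ℤ), n < r' ∧ (n : ℤ) + b = r' * k := by
    refine ⟨((-(b : ℤ)) % r').toNat, -((-(b : ℤ)) / r'), ?_, ?_⟩
    · have := Int.emod_lt_of_pos (-(b : ℤ)) (b := (r' : ℤ)) (by omega)
      have := Int.emod_nonneg (-(b : ℤ)) hp1
      omega
    · rw [Int.toNat_of_nonneg (Int.emod_nonneg _ hp1)]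
      have := Int.emod_add_mul_ediv (-(b : ℤ)) r'
      linear_combination this
  have hnb' : (n : ℂ) + b = r' * k := by exact_mod_cast hnb
  have hST := S_Tel r r' hr hp0 h α Kp En Fn Kn hn S hSK b n k hnb
  have hSFd : S (Fdiv r Fp c) = ((-1) ^ c * qp r (-(c * (c + 1)))) • (Fdiv r Fn c * Kn c) := by
    unfold Fdiv
    rw [map_smul, S_pow S hSmul hS1, hSF, ← neg_one_smul ℂ (Kn 1 * Fn), smul_pow, KF_pow hn,
      smul_mul_assoc, smul_smul, smul_smul, smul_smul]
    congr 1
    ring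
  have hSEp : S (Ep ^ c') = ((-1) ^ c' * qp r (-(c' * (c' - 1)))) • (En ^ c' * Kn (-c')) := by
    rw [S_pow S hSmul hS1, hSE, ← neg_one_smul ℂ (En * Kn (-1)), smul_pow, EK_pow hn, smul_smul]
  have hKT := K_Tel hr hp0 h hn ((c : ℤ) - c' - b') n (2 * n + (-α)) (by push_cast; ring)
  have hmain : S (Tel r r' Kp (2 * (b : ℂ) + α) 0 * Fdiv r Fp c * Kp (b' : ℂ) * Ep ^ c') =
      ((-1) ^ c' * (-1) ^ c * qp r (-(c' * (c' - 1)) + -(c * (c + 1)) + 2 * (c' + b') * c +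
        (2 * n + (-α)) * (c - c' - b'))) •
        (En ^ c' * Fdiv r Fn c * Tel r r' Kn (2 * n + (-α)) 0) := by
    rw [hSmul, hSmul, hSmul, hST, hSFd, hSEp, hSK]
    push_cast at hKT
    have e1 : (En ^ c' * Kn (-c')) * (Kn (-b') * ((Fdiv r Fn c * Kn c) * Tel r r' Kn (2 * n + (-α)) 0))
        = qp r (2 * (c' + b') * c + (2 * n + (-α)) * (c - c' - b')) •
        (En ^ c' * Fdiv r Fn c * Tel r r' Kn (2 * n + (-α)) 0) := by
      calc _ = En ^ c' * ((Kn (-c') * Kn (-b')) * Fdiv r Fn c) * (Kn c * Tel r r' Kn (2 * n + (-α)) 0) := by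
            simp only [mul_assoc]
        _ = qp r (2 * (c' + b') * c) • (En ^ c' * Fdiv r Fn c *
              ((Kn (-c' + -b') * Kn c) * Tel r r' Kn (2 * n + (-α)) 0)) := by
            rw [hn.1, K_Fdiv hn, mul_smul_comm, smul_mul_assoc]
            simp only [mul_assoc]
            congr 2
            ring
        _ = _ := by
            rw [hn.1, show (-c' + -b' + c : ℂ) = c - c' - b' by ring, hKT, mul_smul_comm, smul_smul,
              ← qp_add]
    simp only [smul_mul_assoc, mul_smul_comm, smul_smul]
    rw [e1, smul_smul]
    congr 1
    simp only [qp_add]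
    ring
  rw [hmain, map_smul, hlam c' c n hc' hc hnlt]
  split_ifs with hcc
  · obtain ⟨rfl, rfl⟩ := hcc
    have hev : Even (r' - 1) := hodd.tsub_odd odd_one
    rw [hev.neg_one_pow, one_mul, one_mul, smul_eq_mul, mul_div_assoc', ← qp_add]
    congr 1
    rw [Nat.cast_sub (by omega)]
    apply qp_congr r r' hr h _ _ (b' - b' * k + (b - (r' - 1) * k))
    push_cast
    linear_combination (-2 * b' - 2 * (r' - 1) : ℂ) * hnb'
  · simp

end anti

/-- Factorizability of quantum `sl₂` for `r'` odd: the Drinfeld map applied to the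
antipode-twisted left integral recovers the cointegral,
`D_{ᾱ,0}(λ_{-α} ∘ S_ᾱ^0) = Λ^α = √r' E^{r'-1} F^{(r'-1)} T_0^α`.  Here the Drinfeld map
`D_{ᾱ,0}(f) = Σ_{i,j} f((R''_i)(R'_j)) (R'_i)(R''_j)` is written out explicitly using the
components of the R-matrices `R_{0,ᾱ} = Σ_{b,c} q^{c(c-1)/2} K^{b+α/2} E^c ⊗ T_{2b+α}^0
F^{(c)}` (index `i`, first leg in `u_0`, second in `u_ᾱ`) and `R_{ᾱ,0} = Σ_{b',c'}
q^{c'(c'-1)/2 - b'α} K^{b'} E^{c'} ⊗ T_{2b'}^{α/2} F^{(c')}` (index `j`, first leg in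
`u_ᾱ`, second in `u_0`); the antipode `S_ᾱ^0 : u_ᾱ → u_{-ᾱ}` and the integral
`λ_{-α} : u_{-ᾱ} → ℂ` are given on generators and on the PBW basis respectively. -/
theorem sl2_factorizable (r r' : ℕ) (hr : 3 ≤ r) (hr' : r' = r / Nat.gcd 2 r)
    (hodd : Odd r') (α : ℂ)
    {Ap An A0 : Type*} [Ring Ap] [Algebra ℂ Ap] [Ring An] [Algebra ℂ An]
    [Ring A0] [Algebra ℂ A0]
    (Ep Fp : Ap) (Kp : ℂ → Ap) (En Fn : An) (Kn : ℂ → An) (E0 F0 : A0) (K0 : ℂ → A0)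
    (hp : SL2Rel r r' α Ep Fp Kp) (hn : SL2Rel r r' (-α) En Fn Kn)
    (h0 : SL2Rel r r' 0 E0 F0 K0)
    (S : Ap →ₗ[ℂ] An)
    (hSmul : ∀ x y : Ap, S (x * y) = S y * S x)
    (hSE : S Ep = -(En * Kn (-1))) (hSF : S Fp = -(Kn 1 * Fn))
    (hSK : ∀ γ : ℂ, S (Kp γ) = Kn (-γ))
    (lam : An →ₗ[ℂ] ℂ)
    (hlam : ∀ ℓ m n : ℕ, ℓ < r' → m < r' → n < r' →
      lam (En ^ ℓ * Fdiv r Fn m * Tel r r' Kn (2 * n + (-α)) 0) =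
        if ℓ = r' - 1 ∧ m = r' - 1 then
          qp r ((2 * (n : ℂ) + (-α)) * (1 - r')) / ((Real.sqrt r' : ℝ) : ℂ) else 0) :
    ∑ b ∈ Finset.range r', ∑ c ∈ Finset.range r',
      ∑ b' ∈ Finset.range r', ∑ c' ∈ Finset.range r',
        (qp r ((c : ℂ) * ((c : ℂ) - 1) / 2 + (c' : ℂ) * ((c' : ℂ) - 1) / 2 - (b' : ℂ) * α) *
          lam (S (Tel r r' Kp (2 * (b : ℂ) + α) 0 * Fdiv r Fp c * Kp (b' : ℂ) * Ep ^ c'))) •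
        (K0 ((b : ℂ) + α / 2) * E0 ^ c * Tel r r' K0 (2 * (b' : ℂ)) (α / 2) * Fdiv r F0 c') =
      ((Real.sqrt r' : ℝ) : ℂ) • (E0 ^ (r' - 1) * Fdiv r F0 (r' - 1) * Tel r r' K0 0 α) := by
  have hcase := r_cases r r' hr'
  have hr0 : 0 < r := by omega
  have hp0 : 0 < r' := by omega
  have hodd' := hodd
  obtain ⟨t, ht⟩ := hodd'
  have ht' : (r' : ℂ) = 2 * t + 1 := by exact_mod_cast ht
  set s : ℂ := ((Real.sqrt r' : ℝ) : ℂ) with hs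
  have hss : s * s = r' := by
    rw [hs, ← Complex.ofReal_mul, Real.mul_self_sqrt (by positivity)]
    simp
  have hrc : (r' : ℂ) ≠ 0 := by exact_mod_cast hp0.ne'
  have hs0 : s ≠ 0 := by
    intro h
    rw [h] at hss
    apply hrc
    rw [← hss]; ring
  have hlamS := lam_S r r' hr0 hp0 hcase hodd α Ep Fp Kp En Fn Kn hp hn S hSmul hSE hSF hSK lam hlam
  have hN : r' - 1 ∈ Finset.range r' := by rw [Finset.mem_range]; omega
  have hNc : ((r' - 1 : ℕ) : ℂ) = r' - 1 := by rw [Nat.cast_sub (by omega)]; simp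
  -- the summand for each `b`
  have hterm : ∀ b : ℕ, (∑ c ∈ Finset.range r',
      ∑ b' ∈ Finset.range r', ∑ c' ∈ Finset.range r',
        (qp r ((c : ℂ) * ((c : ℂ) - 1) / 2 + (c' : ℂ) * ((c' : ℂ) - 1) / 2 - (b' : ℂ) * α) *
          lam (S (Tel r r' Kp (2 * (b : ℂ) + α) 0 * Fdiv r Fp c * Kp (b' : ℂ) * Ep ^ c'))) •
        (K0 ((b : ℂ) + α / 2) * E0 ^ c * Tel r r' K0 (2 * (b' : ℂ)) (α / 2) * Fdiv r F0 c')) =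
      s⁻¹ • (E0 ^ (r' - 1) * Fdiv r F0 (r' - 1) * K0 (2 * b - 1 + α)) := by
    intro b
    rw [Finset.sum_eq_single_of_mem _ hN]
    rotate_left
    · intro c hc hcN
      refine Finset.sum_eq_zero fun b' _ => Finset.sum_eq_zero fun c' hc' => ?_
      rw [hlamS b c b' c' (Finset.mem_range.mp hc) (Finset.mem_range.mp hc'), if_neg (by tauto)]
      simp
    have hinner : ∀ b' ∈ Finset.range r', (∑ c' ∈ Finset.range r',
        (qp r (((r' - 1 : ℕ) : ℂ) * (((r' - 1 : ℕ) : ℂ) - 1) / 2 + (c' : ℂ) * ((c' : ℂ) - 1) / 2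
            - (b' : ℂ) * α) *
          lam (S (Tel r r' Kp (2 * (b : ℂ) + α) 0 * Fdiv r Fp (r' - 1) * Kp (b' : ℂ) * Ep ^ c'))) •
        (K0 ((b : ℂ) + α / 2) * E0 ^ (r' - 1) * Tel r r' K0 (2 * (b' : ℂ)) (α / 2) *
          Fdiv r F0 c')) =
        (s⁻¹ * qp r (2 - 2 * b + α * (r' - 1))) • (K0 ((b : ℂ) + α / 2) * E0 ^ (r' - 1) *
          (qp r (2 * (b - 1) * b') • Tel r r' K0 (2 * (b' : ℂ)) (α / 2)) * Fdiv r F0 (r' - 1)) := by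
      intro b' _
      rw [Finset.sum_eq_single_of_mem _ hN]
      · rw [hlamS b _ b' _ (Finset.mem_range.mp hN) (Finset.mem_range.mp hN), if_pos ⟨rfl, rfl⟩,
          hNc, mul_smul_comm, smul_mul_assoc, smul_smul]
        congr 1
        rw [mul_div_assoc', ← qp_add, mul_assoc, ← qp_add, div_eq_inv_mul]
        congr 1
        apply qp_congr r r' hr0 hcase _ _ (t - 1)
        rw [ht']
        push_cast
        ring
      · intro c' hc' hcN
        rw [hlamS b _ b' c' (Finset.mem_range.mp hN) (Finset.mem_range.mp hc'), if_neg (by tauto)]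
        simp
    rw [Finset.sum_congr rfl hinner, ← Finset.smul_sum, ← Finset.sum_mul, ← Finset.mul_sum]
    have hT : ∑ b' ∈ Finset.range r', qp r (2 * (b - 1) * b') • Tel r r' K0 (2 * (b' : ℂ)) (α / 2)
        = K0 (b - 1 + α / 2) := by
      unfold Tel
      simp only [Finset.smul_sum, smul_smul]
      rw [Finset.sum_comm]
      have h1 : ∀ a ∈ Finset.range r', ∑ b' ∈ Finset.range r',
          (qp r (2 * (b - 1) * b') * ((r' : ℂ)⁻¹ * qp r (-(2 * b' * a)))) • K0 (a + α / 2)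
          = if (r' : ℤ) ∣ (b : ℤ) - 1 - a then K0 (a + α / 2) else 0 := by
        intro a _
        rw [← Finset.sum_smul]
        have h2 := qp_geom r r' hr0 hcase hodd ((b : ℤ) - 1 - a)
        have h3 : ∑ b' ∈ Finset.range r',
          (qp r (2 * (b - 1) * b') * ((r' : ℂ)⁻¹ * qp r (-(2 * b' * a)))) =
          (r' : ℂ)⁻¹ * (if (r' : ℤ) ∣ (b : ℤ) - 1 - a then (r' : ℂ) else 0) := by
          rw [← h2, Finset.mul_sum]
          refine Finset.sum_congr rfl fun b' _ => ?_
          rw [mul_left_comm, ← qp_add]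
          congr 2
          push_cast
          ring
        rw [h3]
        split_ifs
        · rw [inv_mul_cancel₀ hrc, one_smul]
        · simp
      rw [Finset.sum_congr rfl h1]
      have hp1 : (r' : ℤ) ≠ 0 := by exact_mod_cast hp0.ne'
      have hnn := Int.emod_nonneg ((b : ℤ) - 1) hp1
      have hlt := Int.emod_lt_of_pos ((b : ℤ) - 1) (b := (r' : ℤ)) (by omega)
      have hdm := Int.emod_add_mul_ediv ((b : ℤ) - 1) r'
      obtain ⟨a0, ha0⟩ := Int.eq_ofNat_of_zero_le hnn
      set k : ℤ := ((b : ℤ) - 1) / r'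
      rw [ha0] at hdm hlt
      have ha0lt : a0 < r' := by exact_mod_cast hlt
      rw [Finset.sum_eq_single_of_mem a0 (Finset.mem_range.mpr ha0lt)]
      · rw [if_pos ⟨k, by linear_combination -hdm⟩]
        have h4 := K_period hcase h0 k
        have hdm' : (a0 : ℂ) + r' * k = b - 1 := by exact_mod_cast hdm
        rw [← hdm', add_right_comm, ← h0.1 _ (r' * k : ℂ), h4, zero_mul, zero_mul, qp_zero, one_smul, mul_one]
      · intro a ha hne
        rw [if_neg]
        intro hd
        apply hne
        have hd' : (r' : ℤ) ∣ (a0 : ℤ) - a := by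
          have : (a0 : ℤ) - a = ((b : ℤ) - 1 - a) - r' * k := by linear_combination hdm
          rw [this]
          exact dvd_sub hd (dvd_mul_right _ _)
        have ha' := Finset.mem_range.mp ha
        have := Int.eq_zero_of_abs_lt_dvd hd' (by rw [abs_lt]; constructor <;> omega)
        omega
    rw [hT, K_E_pow h0, smul_mul_assoc, smul_mul_assoc, mul_assoc (E0 ^ _) (K0 _) (K0 _), h0.1,
      mul_assoc (E0 ^ _) (K0 _) (Fdiv _ _ _), K_Fdiv h0, mul_smul_comm, smul_smul, smul_smul,
      ← mul_assoc (E0 ^ _), hNc]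
    have h5 : s⁻¹ * qp r (2 - 2 * b + α * (r' - 1)) * (qp r (2 * (b + α / 2) * (r' - 1)) *
        qp r (-(2 * (b + α / 2 + (b - 1 + α / 2)) * (r' - 1)))) = s⁻¹ := by
      rw [mul_assoc, ← qp_add, ← qp_add]
      conv_rhs => rw [← mul_one s⁻¹, ← qp_zero r]
      congr 1
      apply qp_congr r r' hr0 hcase _ _ (1 - b)
      push_cast
      ring
    congr 1
    · simpa only [mul_assoc] using h5
    · congr 2
      ring
  rw [Finset.sum_congr rfl (fun b _ => hterm b), ← Finset.smul_sum, ← Finset.mul_sum]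
  have hfin : ∑ b ∈ Finset.range r', K0 (2 * (b : ℂ) - 1 + α) = (r' : ℂ) • Tel r r' K0 0 α := by
    unfold Tel
    rw [smul_smul, mul_inv_cancel₀ hrc, one_smul]
    have key := sum_reindex r' hp0 (fun a : ℤ => K0 (a + α)) ?_ (fun b => 2 * (b : ℤ) - 1) ?_
    · push_cast at key
      rw [key]
      refine Finset.sum_congr rfl fun b _ => ?_
      simp [qp_zero]
    · intro a k
      have h4 := K_period hcase h0 k
      push_cast
      rw [add_right_comm, ← h0.1 _ (r' * k : ℂ), h4, zero_mul, zero_mul, qp_zero, one_smul, mul_one]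
    · intro a b ha hb hd
      have hd' : (r' : ℤ) ∣ 2 * ((a : ℤ) - b) := by
        convert hd using 1
        ring
      have hc : IsCoprime (r' : ℤ) 2 := by
        rw [Int.isCoprime_iff_gcd_eq_one]
        exact_mod_cast (Nat.coprime_two_right.mpr hodd)
      have := Int.eq_zero_of_abs_lt_dvd (hc.dvd_of_dvd_mul_left hd')
        (by rw [abs_lt]; constructor <;> omega)
      omega
  rw [hfin, mul_smul_comm, smul_smul]
  congr 1
  rw [← hss]
  field_simp


end
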